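/- Let K be an algebraically closed field of characteristic zero and m, r ≥ 1. Let R be the ring of SL_m-invariants: the K-subalgebra of the polynomial ring in the r·m² variable entries of r generic m×m matrices consisting of those f with f(PA₁P⁻¹,…,PA_rP⁻¹) = f(A₁,…,A_r) for all P ∈ SL_m(K) and all m×m matrices A₁,…,A_r over K. Let S ⊆ R be a finite set of homogeneous invariants that is separating: for any tuples A, A′ ∈ (M_m(K))^r such that f(A) ≠ f(A′) for some invariant f ∈ R, there exists s ∈ S with s(A) ≠ s(A′). Then R is integral over the K-subalgebra of R generated by S. (The instance of the Derksen–Kemper separating-set theorem used for the ring of matrix invariants.) -/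

import Mathlib

open MvPolynomial Matrix

/-- `f` is an `SL_m`-invariant: `f(PA₁P⁻¹, …, PA_rP⁻¹) = f(A₁, …, A_r)` for every
`P ∈ SL_m(K)` and every tuple of `m × m` matrices `A₁, …, A_r` over `K`. -/
def IsMatrixInvariant (K : Type*) [Field K] (r m : ℕ)
    (f : MvPolynomial (Fin r × Fin m × Fin m) K) : Prop :=
  ∀ (P : Matrix.SpecialLinearGroup (Fin m) K) (A : Fin r → Matrix (Fin m) (Fin m) K),
    MvPolynomial.eval
        (fun p : Fin r × Fin m × Fin m => (P.1 * A p.1 * (P⁻¹).1) p.2.1 p.2.2) f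
      = MvPolynomial.eval (fun p : Fin r × Fin m × Fin m => A p.1 p.2.1 p.2.2) f

namespace MvPolynomial

section HilbertNullcone

variable {σ K : Type*} [Field K]

theorem homogeneousComponent_add_mul_of_isHomogeneous {t : MvPolynomial σ K} {d : ℕ}
    (ht : t.IsHomogeneous d) (n : ℕ) (c : MvPolynomial σ K) :
    homogeneousComponent (d + n) (t * c) = t * homogeneousComponent n c := by
  let := gradedAlgebra (σ := σ) (R := K)
  have h := DirectSum.coe_decompose_mul_add_of_left_mem (homogeneousSubmodule σ K) (i := d)
    (j := n) (a := t) (b := c) ht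
  have e : ∀ (p : MvPolynomial σ K) (i : ℕ),
      (DirectSum.decompose (homogeneousSubmodule σ K) p i : MvPolynomial σ K)
        = homogeneousComponent i p := fun p i => decomposition.decompose'_apply p i
  rwa [e, e] at h

theorem homogeneousComponent_mul_eq_zero_of_lt {t : MvPolynomial σ K} {d : ℕ}
    (ht : t.IsHomogeneous d) {n : ℕ} (hn : n < d) (c : MvPolynomial σ K) :
    homogeneousComponent n (t * c) = 0 := by
  let := gradedAlgebra (σ := σ) (R := K)
  have h := DirectSum.coe_decompose_mul_of_left_mem_of_not_le (homogeneousSubmodule σ K) (i := d)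
    (n := n) (a := t) (b := c) ht (by lia)
  have e : ∀ (p : MvPolynomial σ K) (i : ℕ),
      (DirectSum.decompose (homogeneousSubmodule σ K) p i : MvPolynomial σ K)
        = homogeneousComponent i p := fun p i => decomposition.decompose'_apply p i
  rwa [e] at h

/-- A graded family of additive projections of the polynomial ring onto a graded subalgebra `R`
which is linear over the homogeneous elements of `R`. -/
structure IsReynolds (R : Subalgebra K (MvPolynomial σ K))
    (ρ : ℕ → MvPolynomial σ K →+ MvPolynomial σ K) : Prop where
  homogeneousComponent_mem : ∀ f ∈ R, ∀ n, homogeneousComponent n f ∈ R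
  mem : ∀ d f, ρ d f ∈ R
  map_one : ρ 0 1 = 1
  map_mul : ∀ u ∈ R, ∀ e, u.IsHomogeneous e → ∀ d f, ρ (e + d) (u * f) = u * ρ d f

variable {R : Subalgebra K (MvPolynomial σ K)} {ρ : ℕ → MvPolynomial σ K →+ MvPolynomial σ K}

/-- Ideals generated by homogeneous elements of `R` contract to the ideals of `R` with the same
generators. -/
theorem IsReynolds.exists_eq_sum_of_mem_span (h : IsReynolds R ρ)
    (T : Finset (MvPolynomial σ K)) (deg : MvPolynomial σ K → ℕ)
    (hT : ∀ t ∈ T, t ∈ R) (hdeg : ∀ t ∈ T, t.IsHomogeneous (deg t))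
    {u : MvPolynomial σ K} {n : ℕ} (hu : u ∈ R) (hn : u.IsHomogeneous n)
    (huT : u ∈ Ideal.span (T : Set (MvPolynomial σ K))) :
    ∃ g : MvPolynomial σ K → MvPolynomial σ K,
      (∀ t ∈ T, g t ∈ R ∧ (deg t ≤ n → (g t).IsHomogeneous (n - deg t)) ∧
        (n < deg t → g t = 0)) ∧ u = ∑ t ∈ T, t * g t := by
  obtain ⟨c, -, hc⟩ := Submodule.mem_span_finset.1 huT
  have key : ∀ c : MvPolynomial σ K → MvPolynomial σ K, u = ∑ t ∈ T, t * c t →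
      u = ∑ t ∈ T, t * (if deg t ≤ n then homogeneousComponent (n - deg t) (c t) else 0) := by
    intro c hc
    conv_lhs => rw [← homogeneousComponent_eq_self hn, hc, map_sum]
    refine Finset.sum_congr rfl fun t ht => ?_
    split_ifs with hle
    · conv_lhs => rw [← Nat.add_sub_cancel' hle]
      exact homogeneousComponent_add_mul_of_isHomogeneous (hdeg t ht) _ _
    · rw [homogeneousComponent_mul_eq_zero_of_lt (hdeg t ht) (by lia), mul_zero]
  have h1 := key c (by rw [← hc]; simp [mul_comm])
  have hρu : ρ n u = u := by
    simpa [h.map_one] using h.map_mul u hu n hn 0 1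
  have h2 : u = ∑ t ∈ T, t * (if deg t ≤ n then
      ρ (n - deg t) (homogeneousComponent (n - deg t) (c t)) else 0) := by
    conv_lhs => rw [← hρu, h1, map_sum]
    refine Finset.sum_congr rfl fun t ht => ?_
    split_ifs with hle
    · conv_lhs => rw [← Nat.add_sub_cancel' hle]
      rw [h.map_mul t (hT t ht) _ (hdeg t ht), Nat.add_sub_cancel' hle]
    · simp
  refine ⟨_, fun t ht => ⟨?_, ?_, ?_⟩, key _ h2⟩
  · split_ifs
    · exact h.homogeneousComponent_mem _ (h.mem _ _) _
    · exact R.zero_mem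
  · intro hle
    simp only [hle, if_true]
    exact homogeneousComponent_isHomogeneous _ _
  · intro hlt
    simp [not_le.2 hlt]

/-- The ideal of the polynomial ring generated by the homogeneous elements of `R` of positive
degree. -/
noncomputable def hilbertIdeal (R : Subalgebra K (MvPolynomial σ K)) : Ideal (MvPolynomial σ K) :=
  Ideal.span {u | u ∈ R ∧ ∃ n, 0 < n ∧ u.IsHomogeneous n}

theorem IsReynolds.exists_forall_mem_hilbertIdeal_pow [Finite σ] (h : IsReynolds R ρ) :
    ∃ M : ℕ, ∀ N n : ℕ, ∀ u ∈ R, u.IsHomogeneous n → N * M ≤ n → u ∈ hilbertIdeal R ^ N := by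
  obtain ⟨T, hTsub, hT⟩ := (Submodule.fg_span_iff_fg_span_finset_subset
    {u | u ∈ R ∧ ∃ n, 0 < n ∧ u.IsHomogeneous n}).1 (IsNoetherian.noetherian (hilbertIdeal R))
  have hTpos : ∀ t ∈ T, ∃ n, 0 < n ∧ t.IsHomogeneous n := fun t ht => (hTsub ht).2
  choose! deg hpos hdeg using hTpos
  refine ⟨T.sup deg + 1, fun N => ?_⟩
  induction N with
  | zero => intro n u _ _ _; simp
  | succ N ih =>
    intro n u hu hn hle
    have hmem : u ∈ hilbertIdeal R :=
      Ideal.subset_span ⟨hu, n, lt_of_lt_of_le (by positivity) hle, hn⟩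
    rw [hilbertIdeal, Ideal.span, hT] at hmem
    obtain ⟨g, hg, hsum⟩ := h.exists_eq_sum_of_mem_span T deg (fun t ht => (hTsub ht).1)
      hdeg hu hn hmem
    rw [hsum]
    refine Ideal.sum_mem _ fun t ht => ?_
    rw [pow_succ']
    refine Ideal.mul_mem_mul (Ideal.subset_span (hTsub ht)) ?_
    have hd : deg t ≤ T.sup deg := Finset.le_sup ht
    rw [add_mul] at hle
    exact ih _ _ (hg t ht).1 ((hg t ht).2.1 (by lia)) (by lia)

/-- **Hilbert's nullcone theorem**: `R` is integral over a subalgebra generated by homogeneous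
elements of positive degree which cut out the common zeros of all such elements of `R`. -/
theorem IsReynolds.isIntegral_of_hilbertIdeal_le_radical [Finite σ] (h : IsReynolds R ρ)
    (T : Finset (MvPolynomial σ K)) (hTR : ∀ t ∈ T, t ∈ R)
    (hThom : ∀ t ∈ T, ∃ d, 0 < d ∧ t.IsHomogeneous d)
    (hrad : hilbertIdeal R ≤ (Ideal.span (T : Set (MvPolynomial σ K))).radical)
    (B : Subalgebra K (MvPolynomial σ K)) (hBR : B ≤ R) (hTB : ∀ t ∈ T, t ∈ B)
    {f : MvPolynomial σ K} (hf : f ∈ R) : IsIntegral B f := by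
  obtain ⟨M, hM⟩ := h.exists_forall_mem_hilbertIdeal_pow
  obtain ⟨N, hN⟩ := Ideal.exists_pow_le_of_le_radical_of_fg hrad (IsNoetherian.noetherian _)
  choose! deg hpos hdeg using hThom
  obtain ⟨w, hw⟩ : (Subalgebra.toSubmodule R ⊓ restrictTotalDegree σ K (N * M)).FG := by
    have : FiniteDimensional K ↥(Subalgebra.toSubmodule R ⊓ restrictTotalDegree σ K (N * M)) :=
      Submodule.finiteDimensional_inf_right _ _
    exact Module.Finite.iff_fg.1 this
  have hwR : ∀ x ∈ w, x ∈ R := fun x hx => by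
    have : x ∈ Subalgebra.toSubmodule R ⊓ restrictTotalDegree σ K (N * M) :=
      hw ▸ Submodule.subset_span hx
    exact this.1
  let L : Submodule B (MvPolynomial σ K) := Submodule.span B w
  have hlow : ∀ x ∈ R, x.totalDegree ≤ N * M → x ∈ L := fun x hx hxd => by
    have : x ∈ Submodule.span K (w : Set (MvPolynomial σ K)) :=
      hw ▸ ⟨hx, (mem_restrictTotalDegree _ _ _).2 hxd⟩
    exact Submodule.span_le_restrictScalars K B _ this
  have hhom : ∀ n, ∀ u ∈ R, u.IsHomogeneous n → u ∈ L := by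
    intro n
    induction n using Nat.strong_induction_on with
    | _ n ih =>
      intro u hu hn
      rcases le_total n (N * M) with hle | hle
      · exact hlow u hu (hn.totalDegree_le.trans hle)
      · obtain ⟨g, hg, hsum⟩ := h.exists_eq_sum_of_mem_span T deg hTR hdeg hu hn
          (hN (hM N n u hu hn hle))
        rw [hsum]
        refine Submodule.sum_mem _ fun t ht => ?_
        have hgL : g t ∈ L := by
          rcases le_or_gt (deg t) n with hd | hd
          · exact ih (n - deg t) (by have := hpos t ht; lia) _ (hg t ht).1 ((hg t ht).2.1 hd)
          · rw [(hg t ht).2.2 hd]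
            exact L.zero_mem
        exact L.smul_mem (⟨t, hTB t ht⟩ : B) hgL
  have hRL : ∀ u ∈ R, u ∈ L := fun u hu => by
    rw [← sum_homogeneousComponent u]
    exact Submodule.sum_mem _ fun n _ => hhom n _ (h.homogeneousComponent_mem u hu n)
      (homogeneousComponent_isHomogeneous _ _)
  have hLR : ∀ u ∈ L, u ∈ R := fun u hu => by
    induction hu using Submodule.span_induction with
    | mem x hx => exact hwR x hx
    | zero => exact R.zero_mem
    | add x y _ _ hx hy => exact R.add_mem hx hy
    | smul b x _ hx => exact R.mul_mem (hBR b.2) hx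
  refine isIntegral_of_smul_mem_submodule L ?_ ⟨w, rfl⟩ f fun x hx =>
    hRL _ (R.mul_mem hf (hLR x hx))
  intro hbot
  have : (1 : MvPolynomial σ K) ∈ L := hRL 1 R.one_mem
  rw [hbot] at this
  exact one_ne_zero ((Submodule.mem_bot B).1 this)

end HilbertNullcone

end MvPolynomial

namespace MvPolynomial

section Apolar

variable {τ k : Type*} [Fintype τ] [CommRing k]

/-- The bilinear form on polynomials for which monomials are pairwise orthogonal and the monomial
with exponents `α` has square length `∏ i, (α i)!`. -/
noncomputable def apolar : MvPolynomial τ k →ₗ[k] MvPolynomial τ k →ₗ[k] k :=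
  (basisMonomials τ k).constr k fun α => ((∏ i, (α i).factorial : ℕ) : k) • lcoeff k α

theorem apolar_monomial (α : τ →₀ ℕ) (a : k) (q : MvPolynomial τ k) :
    apolar (monomial α a) q = a * (((∏ i, (α i).factorial : ℕ) : k) * coeff α q) := by
  have h : (monomial α a : MvPolynomial τ k) = a • basisMonomials τ k α := by
    rw [coe_basisMonomials, smul_monomial, smul_eq_mul, mul_one]
  rw [h, map_smul, apolar, Module.Basis.constr_basis]
  simp

theorem apolar_eq_sum (p q : MvPolynomial τ k) :
    apolar p q =
      ∑ α ∈ p.support, coeff α p * (((∏ i, (α i).factorial : ℕ) : k) * coeff α q) := by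
  conv_lhs => rw [p.as_sum]
  simp only [map_sum, LinearMap.sum_apply, apolar_monomial]

theorem apolar_map {k' : Type*} [CommRing k'] (φ : k →+* k') (p q : MvPolynomial τ k) :
    apolar (map φ p) (map φ q) = φ (apolar p q) := by
  induction p using MvPolynomial.monomial_add_induction_on with
  | C a => simp [← monomial_zero', map_monomial, apolar_monomial, coeff_map]
  | monomial_add α a p _ _ ih => simp [map_monomial, apolar_monomial, coeff_map, ih]

theorem prod_factorial_add_single (α : τ →₀ ℕ) (i : τ) :
    ∏ j, ((α + Finsupp.single i 1 : τ →₀ ℕ) j).factorial = (α i + 1) * ∏ j, (α j).factorial := by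
  classical
  rw [← Finset.mul_prod_erase _ _ (Finset.mem_univ i),
    ← Finset.mul_prod_erase _ (fun j => (α j).factorial) (Finset.mem_univ i), ← mul_assoc]
  congr 1
  · simp [Nat.factorial_succ]
  · refine Finset.prod_congr rfl fun j hj => ?_
    simp [(Finset.ne_of_mem_erase hj).symm]

theorem apolar_X_mul (i : τ) (p q : MvPolynomial τ k) :
    apolar (X i * p) q = apolar p (pderiv i q) := by
  have key : ∀ (α : τ →₀ ℕ) (a : k),
      apolar (X i * monomial α a) q = apolar (monomial α a) (pderiv i q) := by
    intro α a
    rw [X, monomial_mul, one_mul, add_comm, apolar_monomial, apolar_monomial,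
      prod_factorial_add_single, coeff_pderiv]
    push_cast
    ring
  rw [p.as_sum]
  simp only [Finset.mul_sum, map_sum, LinearMap.sum_apply, key]

/-- Multiplication by a polynomial has an adjoint for the apolar form. -/
theorem exists_apolar_mul_eq (p : MvPolynomial τ k) :
    ∃ D : MvPolynomial τ k → MvPolynomial τ k, ∀ r q, apolar (p * r) q = apolar r (D q) := by
  induction p using MvPolynomial.induction_on with
  | C a => exact ⟨fun q => a • q, fun r q => by simp [← smul_eq_C_mul]⟩
  | add p₁ p₂ h₁ h₂ =>
    obtain ⟨D₁, h₁⟩ := h₁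
    obtain ⟨D₂, h₂⟩ := h₂
    exact ⟨fun q => D₁ q + D₂ q, fun r q => by simp [add_mul, h₁, h₂]⟩
  | mul_X p i h =>
    obtain ⟨D, h⟩ := h
    exact ⟨fun q => pderiv i (D q), fun r q => by rw [mul_assoc, h, apolar_X_mul]⟩

theorem eq_of_forall_apolar_eq [IsDomain k] [CharZero k] {p q : MvPolynomial τ k}
    (h : ∀ r, apolar r p = apolar r q) : p = q := by
  ext α
  have hα := h (monomial α 1)
  rw [apolar_monomial, apolar_monomial, one_mul, one_mul] at hα
  exact mul_left_cancel₀ (Nat.cast_ne_zero.2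
    (Finset.prod_ne_zero_iff.2 fun i _ => (α i).factorial_ne_zero)) hα

theorem apolar_self_pos {p : MvPolynomial τ ℤ} (hp : p ≠ 0) : 0 < apolar p p := by
  rw [apolar_eq_sum]
  refine Finset.sum_pos (fun α hα => ?_) (support_nonempty.2 hp)
  have h1 : coeff α p ≠ 0 := mem_support_iff.1 hα
  have h2 : (0 : ℤ) < ((∏ i, (α i).factorial : ℕ) : ℤ) :=
    Nat.cast_pos.2 (Finset.prod_pos fun i _ => (α i).factorial_pos)
  have h3 : 0 < coeff α p * coeff α p := mul_self_pos.2 h1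
  nlinarith [mul_pos h2 h3]

end Apolar

section RightMul

variable {n k : Type*} [Fintype n] [CommRing k]

/-- The substitution `z ↦ z * g` in polynomials in the entries of a square matrix `z`. -/
noncomputable def rightMul (g : Matrix n n k) :
    MvPolynomial (n × n) k →ₐ[k] MvPolynomial (n × n) k :=
  aeval fun x => ∑ l, X (x.1, l) * C (g l x.2)

theorem rightMul_X (g : Matrix n n k) (i j : n) :
    rightMul g (X (i, j)) = ∑ l, X (i, l) * C (g l j) := by
  simp [rightMul]

theorem eval_rightMul (g z : Matrix n n k) (p : MvPolynomial (n × n) k) :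
    eval (fun x => z x.1 x.2) (rightMul g p) = eval (fun x => (z * g) x.1 x.2) p := by
  have h : (aeval fun x => z x.1 x.2 : MvPolynomial (n × n) k →ₐ[k] k).comp (rightMul g)
      = aeval fun x => (z * g) x.1 x.2 := by
    ext ⟨i, j⟩
    simp [rightMul_X, Matrix.mul_apply]
  exact DFunLike.congr_fun h p

theorem pderiv_rightMul (g : Matrix n n k) (i j : n) (q : MvPolynomial (n × n) k) :
    pderiv (i, j) (rightMul g q) = ∑ l, C (g j l) * rightMul g (pderiv (i, l) q) := by
  classical
  induction q using MvPolynomial.induction_on with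
  | C a => simp [rightMul]
  | add p q hp hq => simp [hp, hq, mul_add, Finset.sum_add_distrib]
  | mul_X p x hp =>
    obtain ⟨a, b⟩ := x
    have h : pderiv (i, j) (rightMul g (X (a, b)))
        = ∑ l, C (g j l) * rightMul g (pderiv (i, l) (X (a, b))) := by
      rw [rightMul_X, map_sum]
      by_cases hai : a = i
      · subst hai
        simp [Pi.single_apply, pderiv_X, Derivation.leibniz, apply_ite, eq_comm]
      · simp [pderiv_X, Derivation.leibniz, hai]
    rw [map_mul, pderiv_mul, hp, h, Finset.sum_mul, Finset.mul_sum, ← Finset.sum_add_distrib]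
    refine Finset.sum_congr rfl fun l _ => ?_
    rw [pderiv_mul, map_add, map_mul, map_mul]
    ring

theorem apolar_rightMul (g : Matrix n n k) (p q : MvPolynomial (n × n) k) :
    apolar (rightMul g p) q = apolar p (rightMul gᵀ q) := by
  induction p using MvPolynomial.induction_on generalizing q with
  | C a =>
    have h : constantCoeff (rightMul gᵀ q) = constantCoeff q := by
      have h1 := eval_rightMul gᵀ 0 q
      rw [zero_mul] at h1
      simpa [constantCoeff_eq, ← eval_zero] using h1
    rw [constantCoeff_eq] at h
    have h2 : rightMul g (C a) = C a := (rightMul g).commutes a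
    rw [h2, ← monomial_zero', apolar_monomial, apolar_monomial, h]
  | add p₁ p₂ h₁ h₂ => simp [h₁, h₂]
  | mul_X p x h =>
    obtain ⟨i, j⟩ := x
    rw [mul_comm p, apolar_X_mul, pderiv_rightMul, map_mul, rightMul_X, Finset.sum_mul,
      map_sum, LinearMap.sum_apply, map_sum]
    refine Finset.sum_congr rfl fun l _ => ?_
    rw [mul_right_comm, mul_comm, ← smul_eq_C_mul, ← smul_eq_C_mul, map_smul, map_smul,
      LinearMap.smul_apply, apolar_X_mul, h, Matrix.transpose_apply]

end RightMul

end MvPolynomial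

namespace MvPolynomial

section Det

variable {n K : Type*} [Fintype n] [DecidableEq n] [Field K]

theorem rightMul_det (g : Matrix n n K) :
    rightMul g (mvPolynomialX n n K).det = C g.det * (mvPolynomialX n n K).det := by
  have h : (rightMul g).mapMatrix (mvPolynomialX n n K)
      = mvPolynomialX n n K * (C : K →+* MvPolynomial (n × n) K).mapMatrix g := by
    ext1 i j
    simp [Matrix.mul_apply, rightMul_X]
  rw [AlgHom.map_det, h, Matrix.det_mul, ← RingHom.map_det, mul_comm]

theorem eval_det_mvPolynomialX (z : Matrix n n K) :
    eval (fun x => z x.1 x.2) (mvPolynomialX n n K).det = z.det := by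
  rw [RingHom.map_det, RingHom.mapMatrix_apply]
  congr 1
  ext i j
  simp

/-- Polynomials in the entries of a matrix that agree on invertible matrices are equal. -/
theorem eq_of_forall_eval_eq_of_det_ne_zero [Infinite K] {p q : MvPolynomial (n × n) K}
    (h : ∀ z : Matrix n n K, z.det ≠ 0 →
      eval (fun x => z x.1 x.2) p = eval (fun x => z x.1 x.2) q) : p = q := by
  refine mul_right_cancel₀ (det_mvPolynomialX_ne_zero n K) (MvPolynomial.funext fun x => ?_)
  have hx := eval_det_mvPolynomialX (K := K) (Matrix.of fun i j => x (i, j))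
  simp only [Matrix.of_apply, Prod.mk.eta] at hx
  rw [map_mul, map_mul, hx]
  by_cases h0 : (Matrix.of fun i j => x (i, j)).det = 0
  · rw [h0, mul_zero, mul_zero]
  · have := h _ h0
    simp only [Matrix.of_apply, Prod.mk.eta] at this
    rw [this]

/-- The functional `q ↦ ⟨q, det ^ d⟩ / ⟨det ^ d, det ^ d⟩`. -/
noncomputable def detFunctional (d : ℕ) (q : MvPolynomial (n × n) K) : K :=
  apolar q ((mvPolynomialX n n K).det ^ d) /
    apolar ((mvPolynomialX n n K).det ^ d) ((mvPolynomialX n n K).det ^ d)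

theorem detFunctional_rightMul {g : Matrix n n K} (hg : g.det = 1) (d : ℕ)
    (q : MvPolynomial (n × n) K) : detFunctional d (rightMul g q) = detFunctional d q := by
  rw [detFunctional, apolar_rightMul, map_pow, rightMul_det, det_transpose, hg, C_1, one_mul,
    detFunctional]

variable [CharZero K]

theorem apolar_det_pow_ne_zero (d : ℕ) :
    apolar ((mvPolynomialX n n K).det ^ d) ((mvPolynomialX n n K).det ^ d) ≠ 0 := by
  have h : (mvPolynomialX n n K).det ^ d
      = map (Int.castRingHom K) ((mvPolynomialX n n ℤ).det ^ d) := by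
    rw [map_pow, RingHom.map_det, RingHom.mapMatrix_apply]
    congr 2
    ext1 i j
    simp
  rw [h, apolar_map, eq_intCast, Int.cast_ne_zero]
  exact (apolar_self_pos (pow_ne_zero d (det_mvPolynomialX_ne_zero n ℤ))).ne'

/-- A weak form of Cayley's identity: the differential operator `det ∂` maps `det ^ (d + 1)` to a
multiple of `det ^ d`. -/
theorem exists_apolar_det_mul_eq (d : ℕ) :
    ∃ b : K, ∀ q, apolar ((mvPolynomialX n n K).det * q) ((mvPolynomialX n n K).det ^ (d + 1))
      = b * apolar q ((mvPolynomialX n n K).det ^ d) := by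
  obtain ⟨D, hD⟩ := exists_apolar_mul_eq (mvPolynomialX n n K).det
  set δ := (mvPolynomialX n n K).det with hδ
  set h := D (δ ^ (d + 1)) with hh
  have hmul : ∀ g : Matrix n n K, g.det ≠ 0 → rightMul g h = C (g.det ^ d) * h := by
    intro g hg
    refine eq_of_forall_apolar_eq fun r => ?_
    have hgt : δ * rightMul gᵀ r = C (g.det⁻¹) * rightMul gᵀ (δ * r) := by
      rw [map_mul, hδ, rightMul_det, det_transpose, ← mul_assoc, ← mul_assoc, ← C_mul,
        inv_mul_cancel₀ hg, C_1, one_mul]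
    calc apolar r (rightMul g h) = apolar (rightMul gᵀ r) h := by
          rw [apolar_rightMul, transpose_transpose]
      _ = g.det⁻¹ * apolar (δ * r) (rightMul g (δ ^ (d + 1))) := by
          rw [hh, ← hD, hgt, ← smul_eq_C_mul, map_smul, LinearMap.smul_apply, apolar_rightMul,
            transpose_transpose, smul_eq_mul]
      _ = g.det⁻¹ * (g.det ^ (d + 1) * apolar (δ * r) (δ ^ (d + 1))) := by
          rw [map_pow, hδ, rightMul_det, mul_pow, ← C_pow, ← smul_eq_C_mul, map_smul, smul_eq_mul]
      _ = g.det ^ d * apolar r h := by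
          rw [hD, ← hh, pow_succ]
          field_simp
      _ = apolar r (C (g.det ^ d) * h) := by
          rw [← smul_eq_C_mul, map_smul, smul_eq_mul]
  have heq : h = C (eval (fun x => (1 : Matrix n n K) x.1 x.2) h) * δ ^ d := by
    refine eq_of_forall_eval_eq_of_det_ne_zero fun z hz => ?_
    have h1 := eval_rightMul z 1 h
    rw [one_mul, hmul z hz, map_mul, eval_C] at h1
    rw [← h1, map_mul, eval_C, map_pow, hδ, eval_det_mvPolynomialX, mul_comm]
  refine ⟨eval (fun x => (1 : Matrix n n K) x.1 x.2) h, fun q => ?_⟩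
  rw [hD, ← hh]
  conv_lhs => rw [heq]
  rw [← smul_eq_C_mul, map_smul, smul_eq_mul]

theorem detFunctional_det_mul (d : ℕ) (q : MvPolynomial (n × n) K) :
    detFunctional (d + 1) ((mvPolynomialX n n K).det * q) = detFunctional d q := by
  obtain ⟨b, hb⟩ := exists_apolar_det_mul_eq (n := n) (K := K) d
  have h1 := hb ((mvPolynomialX n n K).det ^ d)
  rw [← pow_succ'] at h1
  have hd := apolar_det_pow_ne_zero (n := n) (K := K) d
  have hd1 := apolar_det_pow_ne_zero (n := n) (K := K) (d + 1)
  rw [h1] at hd1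
  rw [detFunctional, detFunctional, hb, h1, mul_div_mul_left _ _ (left_ne_zero_of_mul hd1)]

theorem detFunctional_det_pow_mul (d e : ℕ) (q : MvPolynomial (n × n) K) :
    detFunctional (e + d) ((mvPolynomialX n n K).det ^ e * q) = detFunctional d q := by
  induction e with
  | zero => simp
  | succ e ih => rw [pow_succ', mul_assoc, add_right_comm, detFunctional_det_mul, ih]

theorem detFunctional_one : detFunctional 0 (1 : MvPolynomial (n × n) K) = 1 := by
  have h := apolar_det_pow_ne_zero (n := n) (K := K) 0
  rw [detFunctional]
  rw [pow_zero] at h ⊢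
  exact div_self h

end Det

section Scaling

variable {σ K : Type*} [Field K]

theorem IsHomogeneous.eval_mul_left {p : MvPolynomial σ K} {n : ℕ} (hp : p.IsHomogeneous n)
    (t : K) (a : σ → K) : eval (fun i => t * a i) p = t ^ n * eval a p := by
  rw [eval_eq, eval_eq, Finset.mul_sum]
  refine Finset.sum_congr rfl fun α hα => ?_
  simp_rw [mul_pow]
  rw [Finset.prod_mul_distrib, Finset.prod_pow_eq_pow_sum, ← hp.degree_eq_sum_deg_support hα]
  ring

theorem eval_mul_left_eq_sum (p : MvPolynomial σ K) (t : K) (a : σ → K) :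
    eval (fun i => t * a i) p =
      ∑ n ∈ Finset.range (p.totalDegree + 1), t ^ n * eval a (homogeneousComponent n p) := by
  conv_lhs => rw [← sum_homogeneousComponent p, map_sum]
  exact Finset.sum_congr rfl fun n _ =>
    (homogeneousComponent_isHomogeneous n p).eval_mul_left t a

theorem eval_homogeneousComponent_eq_of_forall_eval_mul_left_eq [Infinite K]
    {p : MvPolynomial σ K} {a b : σ → K}
    (h : ∀ t : K, eval (fun i => t * a i) p = eval (fun i => t * b i) p) (n : ℕ) :
    eval a (homogeneousComponent n p) = eval b (homogeneousComponent n p) := by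
  let P : (σ → K) → Polynomial K := fun a =>
    ∑ n ∈ Finset.range (p.totalDegree + 1),
      Polynomial.monomial n (eval a (homogeneousComponent n p))
  have hP : P a = P b := Polynomial.funext fun t => by
    simpa [P, Polynomial.eval_finsetSum, eval_mul_left_eq_sum, mul_comm] using h t
  rcases lt_or_ge p.totalDegree n with hn | hn
  · rw [homogeneousComponent_eq_zero _ _ hn, map_zero, map_zero]
  · have hc := congrArg (fun q => Polynomial.coeff q n) hP
    simpa [P, Polynomial.finsetSum_coeff, Polynomial.coeff_monomial, Nat.lt_succ_of_le hn] using hc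

end Scaling

end MvPolynomial

section MatrixInvariants

variable {K : Type*} [Field K] {r m : ℕ}

/-- The point of affine space given by the entries of a tuple of matrices. -/
def entries {k : Type*} (A : Fin r → Matrix (Fin m) (Fin m) k) : Fin r × Fin m × Fin m → k :=
  fun p => A p.1 p.2.1 p.2.2

/-- The algebra of `SL_m`-invariant polynomials. -/
def matrixInvariants (K : Type*) [Field K] (r m : ℕ) :
    Subalgebra K (MvPolynomial (Fin r × Fin m × Fin m) K) where
  carrier := {f | IsMatrixInvariant K r m f}
  mul_mem' hf hg P A := by rw [map_mul, map_mul, hf P A, hg P A]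
  add_mem' hf hg P A := by rw [map_add, map_add, hf P A, hg P A]
  algebraMap_mem' c P A := by simp

theorem homogeneousComponent_mem_matrixInvariants [Infinite K]
    {f : MvPolynomial (Fin r × Fin m × Fin m) K} (hf : f ∈ matrixInvariants K r m) (n : ℕ) :
    homogeneousComponent n f ∈ matrixInvariants K r m := by
  intro P A
  refine eval_homogeneousComponent_eq_of_forall_eval_mul_left_eq (fun t => ?_) n
  have h := hf P (fun i => t • A i)
  simpa [Matrix.mul_smul, Matrix.smul_mul] using h

/-- The polynomial `f(z A₁ adj(z), …, z A_r adj(z))` in the entries of a matrix `z`. -/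
noncomputable def conjSubst {k : Type*} [CommRing k] [Algebra K k]
    (A : Fin r → Matrix (Fin m) (Fin m) k) :
    MvPolynomial (Fin r × Fin m × Fin m) K →ₐ[K] MvPolynomial (Fin m × Fin m) k :=
  aeval (entries fun i => mvPolynomialX (Fin m) (Fin m) k * (A i).map C *
    (mvPolynomialX (Fin m) (Fin m) k).adjugate)

theorem eval_conjSubst (A : Fin r → Matrix (Fin m) (Fin m) K) (z : Matrix (Fin m) (Fin m) K)
    (f : MvPolynomial (Fin r × Fin m × Fin m) K) :
    eval (fun x => z x.1 x.2) (conjSubst A f)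
      = eval (entries fun i => z * A i * z.adjugate) f := by
  have hz : (eval fun x : Fin m × Fin m => z x.1 x.2).mapMatrix
      (mvPolynomialX (Fin m) (Fin m) K) = z := by
    ext i j
    simp
  have h : (aeval fun x => z x.1 x.2 : MvPolynomial (Fin m × Fin m) K →ₐ[K] K).comp (conjSubst A)
      = aeval (entries fun i => z * A i * z.adjugate) := by
    ext ⟨i, j, l⟩
    have hm : (eval fun x : Fin m × Fin m => z x.1 x.2).mapMatrix
        (mvPolynomialX (Fin m) (Fin m) K * (A i).map C *
          (mvPolynomialX (Fin m) (Fin m) K).adjugate) = z * A i * z.adjugate := by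
      rw [map_mul, map_mul, RingHom.map_adjugate, hz]
      congr 2
      ext a b
      simp
    simpa [conjSubst, entries] using congrFun (congrFun hm j) l
  exact DFunLike.congr_fun h f

/-- The tuple of generic matrices. -/
noncomputable def genericMatrices (K : Type*) [Field K] (r m : ℕ) :
    Fin r → Matrix (Fin m) (Fin m) (MvPolynomial (Fin r × Fin m × Fin m) K) :=
  fun i => Matrix.of fun j l => X (i, j, l)

theorem map_eval_conjSubst_genericMatrices (A : Fin r → Matrix (Fin m) (Fin m) K)
    (f : MvPolynomial (Fin r × Fin m × Fin m) K) :
    map (eval (entries A)) (conjSubst (genericMatrices K r m) f) = conjSubst A f := by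
  have hz : (map (eval (entries A))).mapMatrix (mvPolynomialX (Fin m) (Fin m) _)
      = mvPolynomialX (Fin m) (Fin m) K := by
    ext1 i j
    simp
  have h : (mapAlgHom (aeval (entries A) : _ →ₐ[K] K)).comp
      (conjSubst (genericMatrices K r m)) = conjSubst A := by
    refine MvPolynomial.algHom_ext fun ⟨i, j, l⟩ => ?_
    have hm : (map (eval (entries A))).mapMatrix (mvPolynomialX (Fin m) (Fin m) _ *
        (genericMatrices K r m i).map C * (mvPolynomialX (Fin m) (Fin m) _).adjugate)
        = mvPolynomialX (Fin m) (Fin m) K * (A i).map C *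
          (mvPolynomialX (Fin m) (Fin m) K).adjugate := by
      rw [map_mul, map_mul, RingHom.map_adjugate, hz]
      congr 2
      ext1 a b
      simp [genericMatrices, entries]
    simpa [conjSubst, entries] using congrFun (congrFun hm j) l
  exact DFunLike.congr_fun h f

theorem conjSubst_conj [Infinite K] (P : Matrix.SpecialLinearGroup (Fin m) K)
    (A : Fin r → Matrix (Fin m) (Fin m) K) (f : MvPolynomial (Fin r × Fin m × Fin m) K) :
    conjSubst (fun i => P.1 * A i * (P⁻¹).1) f = rightMul P.1 (conjSubst A f) := by
  refine eq_of_forall_eval_eq_of_det_ne_zero fun z _ => ?_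
  rw [eval_rightMul, eval_conjSubst, eval_conjSubst, Matrix.adjugate_mul_distrib]
  simp only [Matrix.SpecialLinearGroup.coe_inv, Matrix.mul_assoc]

theorem conjSubst_of_isHomogeneous [IsAlgClosed K] (hm : 1 ≤ m)
    {u : MvPolynomial (Fin r × Fin m × Fin m) K} (hu : u ∈ matrixInvariants K r m) {e : ℕ}
    (he : u.IsHomogeneous e) (A : Fin r → Matrix (Fin m) (Fin m) K) :
    conjSubst A u = C (eval (entries A) u) * (mvPolynomialX (Fin m) (Fin m) K).det ^ e := by
  refine eq_of_forall_eval_eq_of_det_ne_zero fun z hz => ?_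
  rw [eval_conjSubst, map_mul, eval_C, map_pow, eval_det_mvPolynomialX]
  obtain ⟨t, ht⟩ := IsAlgClosed.exists_pow_nat_eq z.det hm
  have ht0 : t ≠ 0 := by
    rintro rfl
    exact hz (by rw [← ht, zero_pow (by lia)])
  have hdet : (t⁻¹ • z).det = 1 := by
    rw [Matrix.det_smul, Fintype.card_fin, ← ht, ← mul_pow, inv_mul_cancel₀ ht0, one_pow]
  have hinv : z.det • (t⁻¹ • z).adjugate = t • z.adjugate := by
    have h1 : (t⁻¹ • z).adjugate = t • z⁻¹ := by
      rw [← inv_eq_left_inv (A := t⁻¹ • z) (B := (t⁻¹ • z).adjugate)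
        (by rw [Matrix.adjugate_mul, hdet, one_smul])]
      refine inv_eq_left_inv ?_
      rw [Matrix.smul_mul, Matrix.mul_smul, Matrix.nonsing_inv_mul _ (isUnit_iff_ne_zero.2 hz),
        smul_smul, mul_inv_cancel₀ ht0, one_smul]
    rw [h1, Matrix.inv_def, Ring.inverse_eq_inv', smul_comm, smul_smul z.det,
      mul_inv_cancel₀ hz, one_smul]
  have hpt : (entries fun i => z * A i * z.adjugate)
      = fun p => z.det * entries (fun i => (t⁻¹ • z) * A i * (t⁻¹ • z).adjugate) p := by
    funext p
    have h2 : z * A p.1 * z.adjugate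
        = z.det • ((t⁻¹ • z) * A p.1 * (t⁻¹ • z).adjugate) := by
      rw [← Matrix.mul_smul, hinv, Matrix.smul_mul, Matrix.smul_mul, Matrix.mul_smul, smul_smul,
        inv_mul_cancel₀ ht0, one_smul]
    exact congrFun (congrFun h2 p.2.1) p.2.2
  have h3 := hu ⟨t⁻¹ • z, hdet⟩ A
  rw [hpt, he.eval_mul_left, mul_comm]
  exact congrArg (· * z.det ^ e) h3

/-- The degree `d` part of the Reynolds operator of `SL_m`, given by Cayley's Ω-process. -/
noncomputable def reynolds (K : Type*) [Field K] (r m d : ℕ) :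
    MvPolynomial (Fin r × Fin m × Fin m) K →+ MvPolynomial (Fin r × Fin m × Fin m) K where
  toFun f := apolar (conjSubst (genericMatrices K r m) f)
      ((mvPolynomialX (Fin m) (Fin m) _).det ^ d) *
    C (apolar ((mvPolynomialX (Fin m) (Fin m) K).det ^ d)
      ((mvPolynomialX (Fin m) (Fin m) K).det ^ d))⁻¹
  map_zero' := by simp
  map_add' f g := by simp [add_mul]

theorem eval_reynolds (A : Fin r → Matrix (Fin m) (Fin m) K) (d : ℕ)
    (f : MvPolynomial (Fin r × Fin m × Fin m) K) :
    eval (entries A) (reynolds K r m d f) = detFunctional d (conjSubst A f) := by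
  have hdet : map (eval (entries A)) ((mvPolynomialX (Fin m) (Fin m) _).det ^ d)
      = (mvPolynomialX (Fin m) (Fin m) K).det ^ d := by
    rw [map_pow, RingHom.map_det]
    congr 2
    ext1 i j
    simp
  change eval (entries A) (_ * C _) = _
  rw [map_mul, eval_C, ← apolar_map, hdet, map_eval_conjSubst_genericMatrices, detFunctional,
    div_eq_mul_inv]

theorem eq_of_forall_eval_entries_eq [Infinite K] {f g : MvPolynomial (Fin r × Fin m × Fin m) K}
    (h : ∀ A : Fin r → Matrix (Fin m) (Fin m) K, eval (entries A) f = eval (entries A) g) :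
    f = g :=
  MvPolynomial.funext fun x => h fun i => Matrix.of fun j l => x (i, j, l)

theorem isReynolds_reynolds [IsAlgClosed K] [CharZero K] (hm : 1 ≤ m) :
    IsReynolds (matrixInvariants K r m) (reynolds K r m) where
  homogeneousComponent_mem _ hf n := homogeneousComponent_mem_matrixInvariants hf n
  mem d f := fun P A => by
    change eval (entries fun i => P.1 * A i * (P⁻¹).1) _ = eval (entries A) _
    rw [eval_reynolds, eval_reynolds, conjSubst_conj, detFunctional_rightMul P.2]
  map_one := eq_of_forall_eval_entries_eq fun A => by
    rw [eval_reynolds, map_one, detFunctional_one, map_one]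
  map_mul u hu e he d f := eq_of_forall_eval_entries_eq fun A => by
    rw [eval_reynolds, map_mul, map_mul, eval_reynolds, conjSubst_of_isHomogeneous hm hu he,
      mul_assoc, ← smul_eq_C_mul, detFunctional, map_smul, LinearMap.smul_apply, smul_eq_mul,
      mul_div_assoc, ← detFunctional, detFunctional_det_pow_mul]

end MatrixInvariants

/-- Derksen–Kemper separating-set theorem for the ring of matrix invariants:
if `S` is a finite set of homogeneous `SL_m`-invariants (for the simultaneous
conjugation action on `r`-tuples of `m × m` matrices) that is separating — any
two tuples distinguished by some invariant are distinguished by some element of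
`S` — then every invariant is integral over the `K`-subalgebra generated by `S`. -/
theorem separating_set_integral (K : Type*) [Field K] [IsAlgClosed K] [CharZero K]
    (m r : ℕ) (hm : 1 ≤ m) (hr : 1 ≤ r)
    (S : Finset (MvPolynomial (Fin r × Fin m × Fin m) K))
    (hShom : ∀ s ∈ S, ∃ d : ℕ, MvPolynomial.IsHomogeneous s d)
    (hSinv : ∀ s ∈ S, IsMatrixInvariant K r m s)
    (hSsep : ∀ A A' : Fin r → Matrix (Fin m) (Fin m) K,
      (∃ f : MvPolynomial (Fin r × Fin m × Fin m) K, IsMatrixInvariant K r m f ∧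
          MvPolynomial.eval (fun p => A p.1 p.2.1 p.2.2) f
            ≠ MvPolynomial.eval (fun p => A' p.1 p.2.1 p.2.2) f) →
      ∃ s ∈ S,
        MvPolynomial.eval (fun p => A p.1 p.2.1 p.2.2) s
          ≠ MvPolynomial.eval (fun p => A' p.1 p.2.1 p.2.2) s)
    (f : MvPolynomial (Fin r × Fin m × Fin m) K) (hf : IsMatrixInvariant K r m f) :
    IsIntegral (Algebra.adjoin K (S : Set (MvPolynomial (Fin r × Fin m × Fin m) K))) f := by
  classical
  let T := S.filter fun s => ∃ d, 0 < d ∧ s.IsHomogeneous d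
  have hST : ∀ s ∈ S, s ∈ T ∨ ∃ c, s = C c := fun s hs => by
    obtain ⟨d, hd⟩ := hShom s hs
    rcases Nat.eq_zero_or_pos d with rfl | hpos
    · exact Or.inr ⟨_, totalDegree_eq_zero_iff_eq_C.1
        ((totalDegree_zero_iff_isHomogeneous _).2 hd)⟩
    · exact Or.inl (Finset.mem_filter.2 ⟨hs, d, hpos, hd⟩)
  have heval : ∀ {p : MvPolynomial (Fin r × Fin m × Fin m) K} {d : ℕ}, 0 < d →
      p.IsHomogeneous d →
      eval (fun q => (0 : Fin r → Matrix (Fin m) (Fin m) K) q.1 q.2.1 q.2.2) p = 0 := by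
    intro p d hd hp
    simpa [hd.ne'] using hp.eval_mul_left 0 (fun _ => (0 : K))
  have hrad : hilbertIdeal (matrixInvariants K r m) ≤
      (Ideal.span (T : Set (MvPolynomial (Fin r × Fin m × Fin m) K))).radical := by
    refine Ideal.span_le.2 ?_
    rintro u ⟨hu, n, hn, hun⟩
    rw [← vanishingIdeal_zeroLocus_eq_radical (K := K)]
    intro x hx
    by_contra hne
    obtain ⟨s, hs, hsx⟩ := hSsep (fun i => Matrix.of fun j l => x (i, j, l)) 0
      ⟨u, hu, by rw [heval hn hun]; exact hne⟩
    rcases hST s hs with hsT | ⟨c, rfl⟩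
    · obtain ⟨d, hd, hsd⟩ := (Finset.mem_filter.1 hsT).2
      rw [heval hd hsd] at hsx
      exact hsx (hx s (Ideal.subset_span hsT))
    · simp at hsx
  exact (isReynolds_reynolds hm).isIntegral_of_hilbertIdeal_le_radical T
    (fun t ht => hSinv t (Finset.mem_filter.1 ht).1) (fun t ht => (Finset.mem_filter.1 ht).2)
    hrad _ (Algebra.adjoin_le hSinv)
    (fun t ht => Algebra.subset_adjoin (Finset.mem_filter.1 ht).1) hf
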